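/- Let m > 2, 0 < a ≤ 1/4, and α = 1/(m−2). Let (z_i)_{i∈ℕ} be an enumeration of ℤ^m in ℝ^m, set r_i = a i^{-α}, and let Ω = ⋃_{i∈ℕ} B(z_i; r_i). Let F_Ω(t) = |Ω| − H_Ω(t) denote the heat loss and let P = ∑_{i=1}^∞ m ω_m (a i^{-α})^{m−1} (the perimeter of Ω), where ω_m is the volume of the unit ball in ℝ^m. Then, as t ↓ 0, F_Ω(t) − π^{-1/2} P t^{1/2} = O(t · log(1/t)). -/

import Mathlib

open MeasureTheory Metric ENNReal

/-- The heat content of an open set `Ω ⊆ ℝᵐ` at time `t`, computed with the Euclidean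
heat kernel `p(x,y;t) = (4πt)^{-m/2} e^{-|x-y|²/(4t)}`. -/
noncomputable def heatContent {m : ℕ} (Ω : Set (EuclideanSpace ℝ (Fin m))) (t : ℝ) :
    ℝ≥0∞ :=
  ∫⁻ x in Ω, ∫⁻ y in Ω,
    ENNReal.ofReal ((4 * Real.pi * t) ^ (-(m : ℝ) / 2) * Real.exp (-dist x y ^ 2 / (4 * t)))

/-- `z : ℕ → ℝᵐ` is an enumeration of the integer lattice `ℤᵐ ⊆ ℝᵐ`. -/
def IsLatticeEnum (m : ℕ) (z : ℕ → EuclideanSpace ℝ (Fin m)) : Prop :=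
  Function.Injective z ∧
    Set.range z = {x : EuclideanSpace ℝ (Fin m) | ∀ j : Fin m, ∃ k : ℤ, x j = (k : ℝ)}

theorem mul_rpow_sub_one_le_rpow_sub_rpow {α x : ℝ} (hα : 0 ≤ α) (hα' : α ≤ 1) (hx : 1 ≤ x) :
    α * x ^ (α - 1) ≤ x ^ α - (x - 1) ^ α := by
  have hx0 : 0 < x := by linarith
  have hinv : x⁻¹ ≤ 1 := inv_le_one_of_one_le₀ hx
  have h := rpow_one_add_le_one_add_mul_self (s := -x⁻¹) (by linarith) hα hα'
  have h2 : (x - 1) ^ α = x ^ α * (1 + -x⁻¹) ^ α := by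
    rw [← Real.mul_rpow hx0.le (by linarith)]
    congr 1
    field_simp
    ring
  rw [h2, Real.rpow_sub_one hx0.ne', div_eq_mul_inv]
  have := mul_le_mul_of_nonneg_left h (Real.rpow_nonneg hx0.le α)
  linarith

theorem mul_rpow_neg_sub_one_le_rpow_neg_sub_rpow_neg {α x : ℝ} (hα : 0 ≤ α) (hα' : α ≤ 1)
    (hx : 1 < x) : α * x ^ (-(1 + α)) ≤ (x - 1) ^ (-α) - x ^ (-α) := by
  have hx0 : 0 < x := by linarith
  have h := mul_rpow_sub_one_le_rpow_sub_rpow hα hα' hx.le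
  rw [show -(1 + α) = -α - 1 by ring, Real.rpow_sub_one hx0.ne', Real.rpow_neg hx0.le,
    Real.rpow_neg (by linarith : (0 : ℝ) ≤ x - 1)]
  rw [Real.rpow_sub_one hx0.ne'] at h
  have hu : 0 < (x - 1) ^ α := Real.rpow_pos_of_pos (by linarith) _
  have hle : (x - 1) ^ α ≤ x ^ α := Real.rpow_le_rpow (by linarith) (by linarith) hα
  generalize (x - 1) ^ α = u at *
  have hv : 0 < x ^ α := by linarith
  generalize x ^ α = v at *
  rw [← sub_nonneg]
  have e : u⁻¹ - v⁻¹ - α * (v⁻¹ / x) =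
      ((v - u - α * (v / x)) + α / x * (v - u)) * (u⁻¹ * v⁻¹) := by
    field_simp
    ring
  rw [e]
  have h1 : 0 ≤ v - u - α * (v / x) := by linarith
  have h2 : 0 ≤ v - u := by linarith
  positivity

theorem sum_range_rpow_le {α : ℝ} (hα : 0 < α) (hα' : α ≤ 1) (N : ℕ) :
    ∑ i ∈ Finset.range N, ((i : ℝ) + 1) ^ (α - 1) ≤ (N : ℝ) ^ α / α := by
  rw [le_div_iff₀' hα, Finset.mul_sum]
  induction N with
  | zero => simp [Real.zero_rpow hα.ne']
  | succ k ih =>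
    rw [Finset.sum_range_succ]
    have := mul_rpow_sub_one_le_rpow_sub_rpow hα.le hα' (x := (k : ℝ) + 1) (by simp)
    push_cast
    simp only [add_sub_cancel_right] at this
    linarith

theorem tsum_rpow_tail_le {α : ℝ} (hα : 0 < α) (hα' : α ≤ 1) {N : ℕ} (hN : 1 ≤ N) :
    ∑' i : ℕ, (((i + N : ℕ) : ℝ) + 1) ^ (-(1 + α)) ≤ (N : ℝ) ^ (-α) / α := by
  refine Real.tsum_le_of_sum_range_le (fun i => by positivity) fun n => ?_
  rw [le_div_iff₀' hα, Finset.mul_sum]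
  suffices ∑ i ∈ Finset.range n, α * (((i + N : ℕ) : ℝ) + 1) ^ (-(1 + α)) ≤
      (N : ℝ) ^ (-α) - ((n + N : ℕ) : ℝ) ^ (-α) by
    have : 0 ≤ ((n + N : ℕ) : ℝ) ^ (-α) := by positivity
    linarith
  induction n with
  | zero => simp
  | succ k ih =>
    rw [Finset.sum_range_succ]
    have hN' : (1 : ℝ) ≤ N := by exact_mod_cast hN
    have := mul_rpow_neg_sub_one_le_rpow_neg_sub_rpow_neg hα.le hα' (x := ((k + N : ℕ) : ℝ) + 1)
      (by push_cast; have : (0 : ℝ) ≤ k := by positivity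
          linarith)
    have e : ((k + 1 + N : ℕ) : ℝ) = ((k + N : ℕ) : ℝ) + 1 := by push_cast; ring
    simp only [add_sub_cancel_right] at this
    rw [e]
    linarith

theorem summable_add_one_rpow_neg {α : ℝ} (hα : 0 < α) :
    Summable fun i : ℕ => ((i : ℝ) + 1) ^ (-(1 + α)) := by
  have := (summable_nat_add_iff 1).2 (Real.summable_nat_rpow (p := -(1 + α)).2 (by linarith))
  simpa using this

/-- A series whose terms are dominated both by `A h³ i^{α-1}` and by `A h i^{-(1+α)}` has
sum `O(h²)`: split it at `i ≈ h^{-1/α}`. -/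
theorem tsum_le_of_le_rpow_of_le_rpow {α A h : ℝ} (hα : 0 < α) (hα' : α ≤ 1) (hA : 0 ≤ A)
    (hh : 0 ≤ h) (hh' : h ≤ 1) {e : ℕ → ℝ} (he : ∀ i, 0 ≤ e i)
    (he₁ : ∀ i : ℕ, e i ≤ A * h ^ 3 * ((i : ℝ) + 1) ^ (α - 1))
    (he₂ : ∀ i : ℕ, e i ≤ A * h * ((i : ℝ) + 1) ^ (-(1 + α))) :
    ∑' i, e i ≤ 3 * A / α * h ^ 2 := by
  rcases hh.eq_or_lt with rfl | h0
  · have : e = 0 := by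
      ext i
      exact le_antisymm (by simpa using he₂ i) (he i)
    simp [this]
  have hs₂ : Summable fun i : ℕ => A * h * ((i : ℝ) + 1) ^ (-(1 + α)) :=
    (summable_add_one_rpow_neg hα).mul_left _
  have hs : Summable e := hs₂.of_nonneg_of_le he he₂
  set X : ℝ := h⁻¹ ^ α⁻¹ with hX
  have hXpos : 0 < X := by positivity
  have hXα : X ^ α = h⁻¹ := Real.rpow_inv_rpow (by positivity) hα.ne'
  set N : ℕ := ⌈X⌉₊ with hN
  have hN1 : 1 ≤ N := Nat.one_le_ceil_iff.2 hXpos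
  have hXN : X ≤ N := Nat.le_ceil X
  have hNX : (N : ℝ) ≤ X + 1 := (Nat.ceil_lt_add_one hXpos.le).le
  have hhead : (N : ℝ) ^ α ≤ 2 * h⁻¹ := by
    calc (N : ℝ) ^ α ≤ (X + 1) ^ α := Real.rpow_le_rpow (by positivity) hNX hα.le
      _ ≤ X ^ α + 1 ^ α := Real.rpow_add_le_add_rpow hXpos.le zero_le_one hα.le hα'
      _ ≤ 2 * h⁻¹ := by
        rw [hXα, Real.one_rpow]
        have := (one_le_inv₀ h0).2 hh'
        linarith
  have htail : (N : ℝ) ^ (-α) ≤ h := by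
    calc (N : ℝ) ^ (-α) ≤ X ^ (-α) := Real.rpow_le_rpow_of_nonpos hXpos hXN (by linarith)
      _ = h := by rw [Real.rpow_neg hXpos.le, hXα, inv_inv]
  rw [← hs.sum_add_tsum_nat_add N]
  have h1 : ∑ i ∈ Finset.range N, e i ≤ A * h ^ 3 * (2 * h⁻¹ / α) := by
    calc ∑ i ∈ Finset.range N, e i
        ≤ ∑ i ∈ Finset.range N, A * h ^ 3 * ((i : ℝ) + 1) ^ (α - 1) :=
          Finset.sum_le_sum fun i _ => he₁ i
      _ = A * h ^ 3 * ∑ i ∈ Finset.range N, ((i : ℝ) + 1) ^ (α - 1) := by rw [Finset.mul_sum]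
      _ ≤ A * h ^ 3 * (2 * h⁻¹ / α) := by
        gcongr
        exact (sum_range_rpow_le hα hα' N).trans (by gcongr)
  have h2 : ∑' i, e (i + N) ≤ A * h * (h / α) := by
    calc ∑' i, e (i + N)
        ≤ ∑' i : ℕ, A * h * (((i + N : ℕ) : ℝ) + 1) ^ (-(1 + α)) :=
          ((summable_nat_add_iff N).2 hs).tsum_le_tsum (fun i => he₂ (i + N))
            ((summable_nat_add_iff N).2 hs₂)
      _ = A * h * ∑' i : ℕ, (((i + N : ℕ) : ℝ) + 1) ^ (-(1 + α)) := tsum_mul_left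
      _ ≤ A * h * (h / α) := by
        gcongr
        exact (tsum_rpow_tail_le hα hα' hN1).trans (by gcongr)
  calc _ ≤ A * h ^ 3 * (2 * h⁻¹ / α) + A * h * (h / α) := add_le_add h1 h2
    _ = 3 * A / α * h ^ 2 := by
      field_simp
      ring

/-- The splitting `ℝⁿ⁺¹ ≃ ℝ × ℝⁿ` of Euclidean space along the first coordinate. -/
def splitFirst (n : ℕ) (x : EuclideanSpace ℝ (Fin (n + 1))) : ℝ × EuclideanSpace ℝ (Fin n) :=
  (x 0, WithLp.toLp 2 fun i => x i.succ)

theorem measurePreserving_splitFirst (n : ℕ) : MeasurePreserving (splitFirst n) :=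
  ((MeasurePreserving.id (volume : Measure ℝ)).prod (PiLp.volume_preserving_toLp (Fin n))).comp
    ((volume_preserving_piFinSuccAbove (fun _ : Fin (n + 1) => ℝ) 0).comp
      (PiLp.volume_preserving_ofLp (Fin (n + 1))))

theorem norm_sq_eq_splitFirst {n : ℕ} (x : EuclideanSpace ℝ (Fin (n + 1))) :
    ‖x‖ ^ 2 = (splitFirst n x).1 ^ 2 + ‖(splitFirst n x).2‖ ^ 2 := by
  simp [EuclideanSpace.norm_sq_eq, Fin.sum_univ_succ, splitFirst]

theorem splitFirst_add_single {n : ℕ} (x : EuclideanSpace ℝ (Fin (n + 1))) (h : ℝ) :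
    splitFirst n (x + EuclideanSpace.single 0 h) =
      ((splitFirst n x).1 + h, (splitFirst n x).2) := by
  ext i <;> simp [splitFirst]

/-- The part of the ball `B(0; r)` that the translation by `z` moves out of the ball. -/
def ballEscape {E : Type*} [NormedAddCommGroup E] (r : ℝ) (z : E) : Set E :=
  {x | ‖x‖ < r ∧ r ≤ ‖x + z‖}

theorem measurableSet_ballEscape {E : Type*} [NormedAddCommGroup E] [MeasurableSpace E]
    [BorelSpace E] (r : ℝ) (z : E) : MeasurableSet (ballEscape r z) := by
  have h₁ : IsOpen {x : E | ‖x‖ < r} := isOpen_lt (by fun_prop) (by fun_prop)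
  have h₂ : IsClosed {x : E | r ≤ ‖x + z‖} := isClosed_le (by fun_prop) (by fun_prop)
  exact h₁.measurableSet.inter h₂.measurableSet

theorem volume_ballEscape_eq_of_norm_eq {E : Type*} [NormedAddCommGroup E]
    [InnerProductSpace ℝ E] [FiniteDimensional ℝ E] [MeasurableSpace E] [BorelSpace E]
    (r : ℝ) {z w : E} (h : ‖z‖ = ‖w‖) :
    volume (ballEscape r z) = volume (ballEscape r w) := by
  set ρ := (Submodule.span ℝ {z - w})ᗮ.reflection
  have hz : ρ z = w := Submodule.reflection_sub h
  rw [← ρ.measurePreserving.measure_preimage (measurableSet_ballEscape r w).nullMeasurableSet]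
  congr 1
  ext x
  simp only [ballEscape, Set.mem_ofPred_eq, Set.mem_preimage, ← hz, ← map_add, ρ.norm_map]

/-- The coordinates in `ℝ × ℝⁿ` of `ballEscape r (h e₀)`. -/
def splitEscape (n : ℕ) (r h : ℝ) : Set (ℝ × EuclideanSpace ℝ (Fin n)) :=
  {p | p.1 ^ 2 + ‖p.2‖ ^ 2 < r ^ 2 ∧ r ^ 2 ≤ (p.1 + h) ^ 2 + ‖p.2‖ ^ 2}

theorem measurableSet_splitEscape (n : ℕ) (r h : ℝ) : MeasurableSet (splitEscape n r h) := by
  have h₁ : IsOpen {p : ℝ × EuclideanSpace ℝ (Fin n) | p.1 ^ 2 + ‖p.2‖ ^ 2 < r ^ 2} :=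
    isOpen_lt (by fun_prop) (by fun_prop)
  have h₂ : IsClosed {p : ℝ × EuclideanSpace ℝ (Fin n) | r ^ 2 ≤ (p.1 + h) ^ 2 + ‖p.2‖ ^ 2} :=
    isClosed_le (by fun_prop) (by fun_prop)
  exact h₁.measurableSet.inter h₂.measurableSet

theorem volume_ballEscape {n : ℕ} {r : ℝ} (hr : 0 < r) (z : EuclideanSpace ℝ (Fin (n + 1))) :
    volume (ballEscape r z) =
      ∫⁻ y : EuclideanSpace ℝ (Fin n), volume ((fun s : ℝ => (s, y)) ⁻¹' splitEscape n r ‖z‖) := by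
  rw [volume_ballEscape_eq_of_norm_eq r (w := EuclideanSpace.single 0 ‖z‖) (by simp),
    ← Measure.prod_apply_symm (measurableSet_splitEscape n r ‖z‖), ← Measure.volume_eq_prod,
    ← (measurePreserving_splitFirst n).measure_preimage
      (measurableSet_splitEscape n r ‖z‖).nullMeasurableSet]
  congr 1
  ext x
  rw [Set.mem_preimage, splitEscape, ballEscape, Set.mem_ofPred_eq, Set.mem_ofPred_eq,
    ← norm_sq_eq_splitFirst, ← sq_lt_sq₀ (norm_nonneg x) hr.le, ← sq_le_sq₀ hr.le (norm_nonneg _),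
    norm_sq_eq_splitFirst (x + _), splitFirst_add_single]

theorem volume_ballEscape_le {n : ℕ} {r : ℝ} (hr : 0 < r) (z : EuclideanSpace ℝ (Fin (n + 1))) :
    volume (ballEscape r z) ≤
      ENNReal.ofReal ‖z‖ * volume (ball (0 : EuclideanSpace ℝ (Fin n)) r) := by
  rw [volume_ballEscape hr, ← setLIntegral_const, ← lintegral_indicator measurableSet_ball]
  refine lintegral_mono fun y => ?_
  by_cases hy : y ∈ ball (0 : EuclideanSpace ℝ (Fin n)) r
  · rw [Set.indicator_of_mem hy]
    set ρ := √(r ^ 2 - ‖y‖ ^ 2)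
    have hy' : ‖y‖ < r := by simpa using hy
    have hρ : ρ ^ 2 = r ^ 2 - ‖y‖ ^ 2 := Real.sq_sqrt (by nlinarith [norm_nonneg y])
    have hρ0 : 0 ≤ ρ := Real.sqrt_nonneg _
    calc volume ((fun s : ℝ => (s, y)) ⁻¹' splitEscape n r ‖z‖)
        ≤ volume (Set.Ico (ρ - ‖z‖) ρ) := by
          refine measure_mono fun s hs => ?_
          obtain ⟨h1, h2⟩ : s ^ 2 + ‖y‖ ^ 2 < r ^ 2 ∧ r ^ 2 ≤ (s + ‖z‖) ^ 2 + ‖y‖ ^ 2 := hs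
          have h3 : |s| < ρ := abs_lt_of_sq_lt_sq (by linarith) hρ0
          have h4 : ρ ≤ |s + ‖z‖| := by
            rw [← abs_of_nonneg hρ0]
            exact sq_le_sq.1 (by linarith)
          rw [abs_lt] at h3
          refine ⟨?_, h3.2⟩
          rcases le_abs.1 h4 with h | h
          · linarith
          · linarith [norm_nonneg z]
      _ = ENNReal.ofReal ‖z‖ := by rw [Real.volume_Ico, _root_.sub_sub_cancel]
  · rw [Set.indicator_of_notMem hy]
    have hy' : r ≤ ‖y‖ := by simpa using hy
    have : (fun s : ℝ => (s, y)) ⁻¹' splitEscape n r ‖z‖ = ∅ := by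
      ext s
      simp only [splitEscape, Set.mem_preimage, Set.mem_ofPred_eq, Set.mem_empty_iff_false,
        iff_false, not_and]
      intro h
      nlinarith [sq_nonneg s]
    simp [this]

theorem le_volume_ballEscape {n : ℕ} {r : ℝ} (hr : 0 < r)
    (z : EuclideanSpace ℝ (Fin (n + 1))) :
    ENNReal.ofReal ‖z‖ *
        volume (ball (0 : EuclideanSpace ℝ (Fin n)) (r * (1 - ‖z‖ ^ 2 / (4 * r ^ 2)))) ≤
      volume (ballEscape r z) := by
  rw [volume_ballEscape hr, ← setLIntegral_const, ← lintegral_indicator measurableSet_ball]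
  refine lintegral_mono fun y => ?_
  refine Set.indicator_apply_le' (fun hy => ?_) (fun _ => zero_le)
  have hy' : ‖y‖ < r * (1 - ‖z‖ ^ 2 / (4 * r ^ 2)) := by simpa using hy
  set u := ‖z‖ ^ 2 / (4 * r ^ 2) with hu
  have hz : ‖z‖ ^ 2 = 4 * r ^ 2 * u := by
    rw [hu]
    field_simp
  have hu0 : 0 ≤ u := by positivity
  have hu1 : u ≤ 1 := by
    by_contra! h
    nlinarith [norm_nonneg y]
  have hyr : ‖y‖ ^ 2 ≤ r ^ 2 * (1 - u) := by
    calc ‖y‖ ^ 2 ≤ (r * (1 - u)) ^ 2 := by gcongr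
      _ = r ^ 2 * (1 - u) * (1 - u) := by ring
      _ ≤ r ^ 2 * (1 - u) * 1 := by
        have : 0 ≤ 1 - u := by linarith
        gcongr
        linarith
      _ = r ^ 2 * (1 - u) := mul_one _
  set ρ := √(r ^ 2 - ‖y‖ ^ 2)
  have hρ : ρ ^ 2 = r ^ 2 - ‖y‖ ^ 2 :=
    Real.sq_sqrt (by nlinarith [mul_nonneg (sq_nonneg r) hu0])
  have hρ0 : 0 ≤ ρ := Real.sqrt_nonneg _
  have hzρ : ‖z‖ ≤ 2 * ρ := abs_le_of_sq_le_sq' (by nlinarith) (by positivity) |>.2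
  calc ENNReal.ofReal ‖z‖ = volume (Set.Ioo (ρ - ‖z‖) ρ) := by
        rw [Real.volume_Ioo, _root_.sub_sub_cancel]
    _ ≤ _ := by
      refine measure_mono fun s hs => ?_
      have h1 : s ^ 2 < ρ ^ 2 := sq_lt_sq' (by linarith [hs.1]) hs.2
      have h2 : ρ ^ 2 ≤ (s + ‖z‖) ^ 2 := by
        have := hs.1
        gcongr
        linarith
      exact ⟨by simp only; linarith, by simp only; linarith⟩

/-- The volume that a translation by `z` moves out of a ball of radius `r` in `ℝⁿ⁺¹` is
`|B(0; r) ∩ ℝⁿ| ‖z‖` to first order. -/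
theorem ballEscape_estimate {n : ℕ} [NeZero n] {r : ℝ} (hr : 0 < r)
    (z : EuclideanSpace ℝ (Fin (n + 1))) :
    0 ≤ volume.real (ball (0 : EuclideanSpace ℝ (Fin n)) 1) * r ^ n * ‖z‖ -
        volume.real (ballEscape r z) ∧
      volume.real (ball (0 : EuclideanSpace ℝ (Fin n)) 1) * r ^ n * ‖z‖ -
          volume.real (ballEscape r z) ≤
        volume.real (ball (0 : EuclideanSpace ℝ (Fin n)) 1) * r ^ n * ‖z‖ *
          (n * (‖z‖ ^ 2 / (4 * r ^ 2))) := by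
  set ω := volume.real (ball (0 : EuclideanSpace ℝ (Fin n)) 1) with hω
  have hω0 : 0 ≤ ω := measureReal_nonneg
  have hball : ∀ s : ℝ, 0 ≤ s → volume.real (ball (0 : EuclideanSpace ℝ (Fin n)) s) = ω * s ^ n := by
    intro s hs
    rw [measureReal_def, Measure.addHaar_ball _ _ hs, ENNReal.toReal_mul,
      ENNReal.toReal_ofReal (by positivity), finrank_euclideanSpace_fin, mul_comm]
    rfl
  have hfin : ∀ s : ℝ, ENNReal.ofReal ‖z‖ * volume (ball (0 : EuclideanSpace ℝ (Fin n)) s) ≠ ⊤ :=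
    fun s => ENNReal.mul_ne_top ENNReal.ofReal_ne_top measure_ball_lt_top.ne
  have hup := ENNReal.toReal_mono (hfin r) (volume_ballEscape_le hr z)
  have hfin' := ne_top_of_le_ne_top (hfin r) (volume_ballEscape_le hr z)
  rw [ENNReal.toReal_mul, ENNReal.toReal_ofReal (norm_nonneg z), ← measureReal_def,
    ← measureReal_def, hball r hr.le] at hup
  set u := ‖z‖ ^ 2 / (4 * r ^ 2) with hu
  refine ⟨by linarith, ?_⟩
  have hn : (1 : ℝ) ≤ n := by exact_mod_cast NeZero.one_le
  rcases le_total u 1 with hu1 | hu1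
  · have hlow := ENNReal.toReal_mono hfin' (le_volume_ballEscape hr z)
    rw [← hu, ENNReal.toReal_mul, ENNReal.toReal_ofReal (norm_nonneg z), ← measureReal_def,
      ← measureReal_def, hball _ (mul_nonneg hr.le (by linarith)), mul_pow] at hlow
    have hb := one_add_mul_le_pow (a := -u) (by linarith) n
    have hc : 0 ≤ ω * r ^ n * ‖z‖ := by positivity
    have := mul_le_mul_of_nonneg_left hb hc
    rw [← sub_eq_add_neg] at this
    linarith
  · have hc : 0 ≤ ω * r ^ n * ‖z‖ := by positivity
    have : 0 ≤ volume.real (ballEscape r z) := measureReal_nonneg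
    nlinarith [mul_le_mul hn hu1 zero_le_one (by linarith)]

/-- The Euclidean heat kernel `p(0, z; t)` on `ℝᵐ`. -/
noncomputable def heatKernel {m : ℕ} (t : ℝ) (z : EuclideanSpace ℝ (Fin m)) : ℝ :=
  (4 * Real.pi * t) ^ (-(m : ℝ) / 2) * Real.exp (-‖z‖ ^ 2 / (4 * t))

theorem heatKernel_nonneg {m : ℕ} {t : ℝ} (ht : 0 < t) (z : EuclideanSpace ℝ (Fin m)) :
    0 ≤ heatKernel t z := by
  unfold heatKernel
  positivity

theorem continuous_heatKernel {m : ℕ} (t : ℝ) :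
    Continuous (heatKernel t : EuclideanSpace ℝ (Fin m) → ℝ) := by
  unfold heatKernel
  fun_prop

theorem pow_mul_gaussian_eq {m : ℕ} (hm : 1 ≤ m) (t : ℝ) (k : ℕ) {y : ℝ} :
    y ^ (m - 1) • (Real.exp (-y ^ 2 / (4 * t)) * y ^ k) =
      y ^ (((m + k : ℕ) : ℝ) - 1) * Real.exp (-(4 * t)⁻¹ * y ^ (2 : ℝ)) := by
  rw [show ((m + k : ℕ) : ℝ) - 1 = ((m - 1 + k : ℕ) : ℝ) by
    push_cast [Nat.cast_sub hm]; ring, Real.rpow_natCast, Real.rpow_two, pow_add, smul_eq_mul,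
    show -y ^ 2 / (4 * t) = -(4 * t)⁻¹ * y ^ 2 by ring]
  ring

theorem integrable_heatKernel_mul_norm_pow {m : ℕ} (hm : 1 ≤ m) {t : ℝ} (ht : 0 < t) (k : ℕ) :
    Integrable fun z : EuclideanSpace ℝ (Fin m) => heatKernel t z * ‖z‖ ^ k := by
  have : NeZero m := ⟨by lia⟩
  simp only [heatKernel, mul_assoc]
  refine Integrable.const_mul ?_ _
  rw [integrable_fun_norm_addHaar volume (f := fun y => Real.exp (-y ^ 2 / (4 * t)) * y ^ k)]
  simp only [finrank_euclideanSpace_fin, pow_mul_gaussian_eq hm]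
  refine integrableOn_rpow_mul_exp_neg_mul_rpow ?_ two_pos (by positivity)
  have : (1 : ℝ) ≤ m := by exact_mod_cast hm
  push_cast
  linarith [(Nat.cast_nonneg k : (0 : ℝ) ≤ k)]

theorem integral_heatKernel_mul_norm_pow {m : ℕ} (hm : 1 ≤ m) {t : ℝ} (ht : 0 < t) (k : ℕ) :
    ∫ z : EuclideanSpace ℝ (Fin m), heatKernel t z * ‖z‖ ^ k =
      m * volume.real (ball (0 : EuclideanSpace ℝ (Fin m)) 1) * Real.pi ^ (-(m : ℝ) / 2) / 2 *
        Real.Gamma (((m : ℝ) + k) / 2) * (4 * t) ^ ((k : ℝ) / 2) := by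
  have : NeZero m := ⟨by lia⟩
  have hm' : (1 : ℝ) ≤ m := by exact_mod_cast hm
  have hk : (0 : ℝ) ≤ k := Nat.cast_nonneg k
  simp only [heatKernel, mul_assoc _ (Real.exp _)]
  rw [integral_const_mul,
    integral_fun_norm_addHaar volume (fun y => Real.exp (-y ^ 2 / (4 * t)) * y ^ k)]
  simp only [finrank_euclideanSpace_fin, pow_mul_gaussian_eq hm]
  rw [integral_rpow_mul_exp_neg_mul_rpow two_pos (by push_cast; linarith) (by positivity),
    mul_right_comm 4 Real.pi t, Real.mul_rpow (by positivity) Real.pi_pos.le,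
    Real.inv_rpow (by positivity), ← Real.rpow_neg (by positivity), nsmul_eq_mul, smul_eq_mul]
  have e : (4 * t) ^ (-(-((((m + k : ℕ) : ℝ) - 1) + 1) / 2)) =
      (4 * t) ^ ((m : ℝ) / 2) * (4 * t) ^ ((k : ℝ) / 2) := by
    rw [← Real.rpow_add (by positivity)]
    congr 1
    push_cast
    ring
  have e' : (4 * t) ^ (-(m : ℝ) / 2) * (4 * t) ^ ((m : ℝ) / 2) = 1 := by
    rw [← Real.rpow_add (by positivity), neg_div, neg_add_cancel, Real.rpow_zero]
  rw [e, sub_add_cancel]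
  push_cast
  linear_combination ((m : ℝ) * volume.real (ball (0 : EuclideanSpace ℝ (Fin m)) 1) *
    Real.pi ^ (-(m : ℝ) / 2) / 2 * Real.Gamma (((m : ℝ) + k) / 2) * (4 * t) ^ ((k : ℝ) / 2)) * e'

theorem volume_real_unitBall {n : ℕ} [NeZero n] :
    volume.real (ball (0 : EuclideanSpace ℝ (Fin n)) 1) =
      Real.pi ^ ((n : ℝ) / 2) / Real.Gamma ((n : ℝ) / 2 + 1) := by
  rw [measureReal_def, EuclideanSpace.volume_ball]
  simp only [ENNReal.ofReal_one, one_pow, one_mul, Fintype.card_fin]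
  rw [ENNReal.toReal_ofReal (div_nonneg (by positivity) (Real.Gamma_pos_of_pos (by positivity)).le),
    Real.sqrt_eq_rpow, ← Real.rpow_mul_natCast Real.pi_pos.le]
  congr 2
  ring

theorem integral_heatKernel {m : ℕ} (hm : 1 ≤ m) {t : ℝ} (ht : 0 < t) :
    ∫ z : EuclideanSpace ℝ (Fin m), heatKernel t z = 1 := by
  have : NeZero m := ⟨by lia⟩
  have hm' : (0 : ℝ) < m := by exact_mod_cast hm
  have h := integral_heatKernel_mul_norm_pow hm ht 0
  simp only [pow_zero, mul_one, Nat.cast_zero, zero_div, Real.rpow_zero, add_zero] at h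
  rw [h, volume_real_unitBall, Real.Gamma_add_one (by positivity), neg_div,
    Real.rpow_neg Real.pi_pos.le]
  have := (Real.Gamma_pos_of_pos (show 0 < (m : ℝ) / 2 by positivity)).ne'
  have : Real.pi ^ ((m : ℝ) / 2) ≠ 0 := by positivity
  field_simp

/-- The first moment of the heat kernel, normalised by the volume of the unit ball one dimension
lower. -/
theorem integral_heatKernel_mul_norm {n : ℕ} [NeZero n] {t : ℝ} (ht : 0 < t) :
    volume.real (ball (0 : EuclideanSpace ℝ (Fin n)) 1) *
        ∫ z : EuclideanSpace ℝ (Fin (n + 1)), heatKernel t z * ‖z‖ =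
      Real.pi ^ (-(1 : ℝ) / 2) *
        ((n + 1 : ℕ) * volume.real (ball (0 : EuclideanSpace ℝ (Fin (n + 1))) 1)) * √t := by
  have h := integral_heatKernel_mul_norm_pow (m := n + 1) (by lia) ht 1
  simp only [pow_one] at h
  rw [h, volume_real_unitBall (n := n), Real.sqrt_eq_rpow,
    show (((n + 1 : ℕ) : ℝ) + (1 : ℕ)) / 2 = (n : ℝ) / 2 + 1 by push_cast; ring,
    Real.mul_rpow (by norm_num) ht.le]
  have h4 : (4 : ℝ) ^ (((1 : ℕ) : ℝ) / 2) = 2 := by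
    rw [show (4 : ℝ) = 2 ^ (2 : ℝ) by norm_num, ← Real.rpow_mul (by norm_num)]
    norm_num
  have hpi : Real.pi ^ (-(1 : ℝ) / 2) =
      Real.pi ^ ((n : ℝ) / 2) * Real.pi ^ (-((n + 1 : ℕ) : ℝ) / 2) := by
    rw [← Real.rpow_add Real.pi_pos]
    congr 1
    push_cast
    ring
  have hG := (Real.Gamma_pos_of_pos (show 0 < (n : ℝ) / 2 + 1 by positivity)).ne'
  rw [h4, hpi, Nat.cast_one]
  field_simp

/-- The part of `Ω` that the translation by `z` moves out of `Ω`. -/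
def translateEscape {E : Type*} [Add E] (Ω : Set E) (z : E) : Set E :=
  {x | x ∈ Ω ∧ x + z ∉ Ω}

theorem measurableSet_setOf_add_mem {m : ℕ} {Ω : Set (EuclideanSpace ℝ (Fin m))}
    (hΩ : MeasurableSet Ω) :
    MeasurableSet {p : EuclideanSpace ℝ (Fin m) × EuclideanSpace ℝ (Fin m) | p.1 + p.2 ∈ Ω} :=
  measurable_add hΩ

theorem heatContent_eq_lintegral {m : ℕ} {Ω : Set (EuclideanSpace ℝ (Fin m))}
    (hΩ : MeasurableSet Ω) (t : ℝ) :
    heatContent Ω t =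
      ∫⁻ z, ENNReal.ofReal (heatKernel t z) * volume (Ω ∩ {x | x + z ∈ Ω}) := by
  have hK : Measurable fun z : EuclideanSpace ℝ (Fin m) => ENNReal.ofReal (heatKernel t z) :=
    (continuous_heatKernel t).measurable.ennreal_ofReal
  have hmeas : Measurable fun p : EuclideanSpace ℝ (Fin m) × EuclideanSpace ℝ (Fin m) =>
      Ω.indicator (1 : EuclideanSpace ℝ (Fin m) → ℝ≥0∞) p.1 *
        (Ω.indicator (1 : EuclideanSpace ℝ (Fin m) → ℝ≥0∞) (p.1 + p.2) * ENNReal.ofReal (heatKernel t p.2)) := by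
    have h1 : Measurable (Ω.indicator (1 : EuclideanSpace ℝ (Fin m) → ℝ≥0∞)) :=
      measurable_one.indicator hΩ
    exact (h1.comp measurable_fst).mul
      ((h1.comp (measurable_fst.add measurable_snd)).mul (hK.comp measurable_snd))
  calc heatContent Ω t
      = ∫⁻ x, ∫⁻ z, Ω.indicator (1 : EuclideanSpace ℝ (Fin m) → ℝ≥0∞) x *
          (Ω.indicator (1 : EuclideanSpace ℝ (Fin m) → ℝ≥0∞) (x + z) * ENNReal.ofReal (heatKernel t z)) := by
        rw [heatContent, ← lintegral_indicator hΩ]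
        refine lintegral_congr fun x => ?_
        by_cases hx : x ∈ Ω
        · simp only [Set.indicator_of_mem hx, Pi.one_apply, one_mul]
          rw [← lintegral_indicator hΩ, ← lintegral_add_left_eq_self _ x]
          refine lintegral_congr fun z => ?_
          by_cases hz : x + z ∈ Ω
          · simp [Set.indicator_of_mem hz, heatKernel]
          · simp [Set.indicator_of_notMem hz]
        · simp [Set.indicator_of_notMem hx]
    _ = ∫⁻ z, ∫⁻ x, Ω.indicator (1 : EuclideanSpace ℝ (Fin m) → ℝ≥0∞) x *
          (Ω.indicator (1 : EuclideanSpace ℝ (Fin m) → ℝ≥0∞) (x + z) * ENNReal.ofReal (heatKernel t z)) :=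
        lintegral_lintegral_swap hmeas.aemeasurable
    _ = _ := by
        refine lintegral_congr fun z => ?_
        have hm : MeasurableSet {x | x + z ∈ Ω} := measurable_add_const z hΩ
        rw [← lintegral_indicator_one (hΩ.inter hm),
          ← lintegral_const_mul _ (measurable_one.indicator (hΩ.inter hm))]
        refine lintegral_congr fun x => ?_
        rw [Set.inter_indicator_one, Pi.mul_apply]
        have : Set.indicator {x | x + z ∈ Ω} (1 : EuclideanSpace ℝ (Fin m) → ℝ≥0∞) x =
            Ω.indicator (1 : EuclideanSpace ℝ (Fin m) → ℝ≥0∞) (x + z) := rfl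
        rw [this]
        ring

theorem measurable_volume_translateEscape {m : ℕ} {Ω : Set (EuclideanSpace ℝ (Fin m))}
    (hΩ : MeasurableSet Ω) : Measurable fun z => volume (translateEscape Ω z) :=
  measurable_measure_prodMk_right
    ((measurable_fst hΩ).inter (measurableSet_setOf_add_mem hΩ).compl)

theorem measurable_volume_inter_translate {m : ℕ} {Ω : Set (EuclideanSpace ℝ (Fin m))}
    (hΩ : MeasurableSet Ω) : Measurable fun z => volume (Ω ∩ {x | x + z ∈ Ω}) :=
  measurable_measure_prodMk_right ((measurable_fst hΩ).inter (measurableSet_setOf_add_mem hΩ))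

/-- The heat loss is the average over the heat kernel of the volume moved out of `Ω`. -/
theorem heatLoss_eq_integral {m : ℕ} (hm : 1 ≤ m) {Ω : Set (EuclideanSpace ℝ (Fin m))}
    (hΩ : MeasurableSet Ω) (hfin : volume Ω ≠ ⊤) {t : ℝ} (ht : 0 < t) :
    heatContent Ω t ≠ ⊤ ∧ (volume Ω).toReal - (heatContent Ω t).toReal =
      ∫ z, heatKernel t z * volume.real (translateEscape Ω z) := by
  have hK : Measurable fun z : EuclideanSpace ℝ (Fin m) => ENNReal.ofReal (heatKernel t z) :=
    (continuous_heatKernel t).measurable.ennreal_ofReal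
  have hone : ∫⁻ z : EuclideanSpace ℝ (Fin m), ENNReal.ofReal (heatKernel t z) = 1 := by
    have hint : Integrable (heatKernel t : EuclideanSpace ℝ (Fin m) → ℝ) := by
      simpa using integrable_heatKernel_mul_norm_pow hm ht 0
    rw [← ofReal_integral_eq_lintegral_ofReal hint (.of_forall (heatKernel_nonneg ht)),
      integral_heatKernel hm ht, ENNReal.ofReal_one]
  have hKV : Measurable fun z => ENNReal.ofReal (heatKernel t z) * volume (Ω ∩ {x | x + z ∈ Ω}) :=
    hK.mul (measurable_volume_inter_translate hΩ)
  have hsum : heatContent Ω t +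
      ∫⁻ z, ENNReal.ofReal (heatKernel t z) * volume (translateEscape Ω z) = volume Ω := by
    rw [heatContent_eq_lintegral hΩ, ← lintegral_add_left hKV]
    calc _ = ∫⁻ z, ENNReal.ofReal (heatKernel t z) * volume Ω := by
          refine lintegral_congr fun z => ?_
          have hm : MeasurableSet {x | x + z ∈ Ω} := measurable_add_const z hΩ
          rw [← mul_add, ← measure_inter_add_sdiff Ω hm]
          rfl
      _ = volume Ω := by rw [lintegral_mul_const _ hK, hone, one_mul]
  have hne := ENNReal.add_ne_top.1 (hsum.symm ▸ hfin)
  refine ⟨hne.1, ?_⟩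
  rw [← hsum, ENNReal.toReal_add hne.1 hne.2, add_sub_cancel_left, integral_eq_lintegral_of_nonneg_ae
    (.of_forall fun z => mul_nonneg (heatKernel_nonneg ht z) measureReal_nonneg)
    ((continuous_heatKernel t).measurable.mul
      (measurable_volume_translateEscape hΩ).ennreal_toReal).aestronglyMeasurable]
  congr 1
  refine lintegral_congr fun z => ?_
  have : volume (translateEscape Ω z) ≠ ⊤ := measure_ne_top_of_subset (fun x hx => hx.1) hfin
  rw [ENNReal.ofReal_mul (heatKernel_nonneg ht z), measureReal_def, ENNReal.ofReal_toReal this]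

/-- If the volume that translation by `z` moves out of `Ω` is `c ‖z‖ + O(‖z‖²)`, then the heat loss
of `Ω` is `c` times the first moment of the heat kernel up to `O(t)`. -/
theorem abs_heatLoss_sub_le {m : ℕ} (hm : 1 ≤ m) {Ω : Set (EuclideanSpace ℝ (Fin m))}
    (hΩ : MeasurableSet Ω) (hfin : volume Ω ≠ ⊤) {c C : ℝ}
    (h : ∀ z, |volume.real (translateEscape Ω z) - c * ‖z‖| ≤ C * ‖z‖ ^ 2) {t : ℝ} (ht : 0 < t) :
    |((volume Ω).toReal - (heatContent Ω t).toReal) -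
        c * ∫ z : EuclideanSpace ℝ (Fin m), heatKernel t z * ‖z‖| ≤
      C * ∫ z : EuclideanSpace ℝ (Fin m), heatKernel t z * ‖z‖ ^ 2 := by
  have hI1 := integrable_heatKernel_mul_norm_pow hm ht 1
  have hI2 := integrable_heatKernel_mul_norm_pow hm ht 2
  simp only [pow_one] at hI1
  have hbound : ∀ z : EuclideanSpace ℝ (Fin m),
      ‖heatKernel t z * volume.real (translateEscape Ω z) - c * (heatKernel t z * ‖z‖)‖ ≤
        C * (heatKernel t z * ‖z‖ ^ 2) := by
    intro z
    rw [show heatKernel t z * volume.real (translateEscape Ω z) - c * (heatKernel t z * ‖z‖) =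
      heatKernel t z * (volume.real (translateEscape Ω z) - c * ‖z‖) by ring, Real.norm_eq_abs,
      abs_mul, abs_of_nonneg (heatKernel_nonneg ht z)]
    calc _ ≤ heatKernel t z * (C * ‖z‖ ^ 2) :=
          mul_le_mul_of_nonneg_left (h z) (heatKernel_nonneg ht z)
      _ = _ := by ring
  have hD : Integrable fun z : EuclideanSpace ℝ (Fin m) =>
      heatKernel t z * volume.real (translateEscape Ω z) - c * (heatKernel t z * ‖z‖) :=
    (hI2.const_mul C).mono' (((continuous_heatKernel t).measurable.mul
      (measurable_volume_translateEscape hΩ).ennreal_toReal).aestronglyMeasurable.sub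
        (hI1.const_mul c).aestronglyMeasurable) (.of_forall hbound)
  have hE : Integrable fun z => heatKernel t z * volume.real (translateEscape Ω z) :=
    (hD.add (hI1.const_mul c)).congr (.of_forall fun z => by simp)
  rw [(heatLoss_eq_integral hm hΩ hfin ht).2, ← integral_const_mul, ← integral_const_mul,
    ← integral_sub hE (hI1.const_mul c), ← Real.norm_eq_abs]
  exact norm_integral_le_of_norm_le (hI2.const_mul C) (.of_forall hbound)

theorem IsLatticeEnum.one_le_dist {m : ℕ} {z : ℕ → EuclideanSpace ℝ (Fin m)}
    (hz : IsLatticeEnum m z) {i j : ℕ} (hij : i ≠ j) : 1 ≤ dist (z i) (z j) := by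
  have hi : z i ∈ Set.range z := ⟨i, rfl⟩
  have hj : z j ∈ Set.range z := ⟨j, rfl⟩
  rw [hz.2] at hi hj
  obtain ⟨l, hl⟩ : ∃ l, z i l ≠ z j l := by
    by_contra! h
    exact hij (hz.1 (PiLp.ext h))
  obtain ⟨p, hp⟩ := hi l
  obtain ⟨q, hq⟩ := hj l
  have hpq : p - q ≠ 0 := fun h => hl (by rw [hp, hq, sub_eq_zero.1 h])
  calc (1 : ℝ) ≤ |((p - q : ℤ) : ℝ)| := by exact_mod_cast Int.one_le_abs hpq
    _ = ‖(z i - z j) l‖ := by simp [hp, hq]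
    _ ≤ ‖z i - z j‖ := PiLp.norm_apply_le _ l
    _ = dist (z i) (z j) := (dist_eq_norm _ _).symm

section SeparatedBalls

variable {m : ℕ} {z : ℕ → EuclideanSpace ℝ (Fin m)} {r : ℕ → ℝ}

theorem pairwise_disjoint_ball (hz : ∀ i j, i ≠ j → 1 ≤ dist (z i) (z j))
    (hr : ∀ i, r i ≤ 1 / 4) : Pairwise fun i j => Disjoint (ball (z i) (r i)) (ball (z j) (r j)) :=
  fun i j hij => ball_disjoint_ball (by linarith [hz i j hij, hr i, hr j])

/-- A translation shorter than the gaps between the balls moves no ball into another one. -/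
theorem translateEscape_iUnion_ball (hz : ∀ i j, i ≠ j → 1 ≤ dist (z i) (z j))
    (hr : ∀ i, r i ≤ 1 / 4) {w : EuclideanSpace ℝ (Fin m)} (hw : ‖w‖ ≤ 1 / 2) :
    translateEscape (⋃ i, ball (z i) (r i)) w =
      ⋃ i, (fun x => x - z i) ⁻¹' ballEscape (r i) w := by
  ext x
  simp only [translateEscape, ballEscape, Set.mem_iUnion, Set.mem_preimage, Set.mem_ofPred_eq,
    mem_ball, dist_eq_norm, not_exists, not_lt]
  constructor
  · rintro ⟨⟨i, hi⟩, h⟩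
    exact ⟨i, hi, by rw [sub_add_eq_add_sub]; exact h i⟩
  · rintro ⟨i, hi, hi'⟩
    refine ⟨⟨i, hi⟩, fun j => ?_⟩
    rw [sub_add_eq_add_sub] at hi'
    rcases eq_or_ne i j with rfl | hij
    · exact hi'
    · have h1 := hz i j hij
      have h2 : z i - z j = (x + w - z j) - (x - z i) - w := by abel
      rw [dist_eq_norm, h2] at h1
      have h3 := norm_sub_le ((x + w - z j) - (x - z i)) w
      have h4 := norm_sub_le (x + w - z j) (x - z i)
      linarith [hr i, hr j]

theorem volume_real_translateEscape_iUnion_ball (hz : ∀ i j, i ≠ j → 1 ≤ dist (z i) (z j))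
    (hr : ∀ i, r i ≤ 1 / 4) {w : EuclideanSpace ℝ (Fin m)} (hw : ‖w‖ ≤ 1 / 2) :
    volume.real (translateEscape (⋃ i, ball (z i) (r i)) w) =
      ∑' i, volume.real (ballEscape (r i) w) := by
  have hsub : ∀ i, (fun x => x - z i) ⁻¹' ballEscape (r i) w ⊆ ball (z i) (r i) := fun i x hx => by
    rw [mem_ball, dist_eq_norm]
    exact hx.1
  have hmeas : ∀ i, MeasurableSet ((fun x => x - z i) ⁻¹' ballEscape (r i) w) := fun i =>
    measurable_sub_const (z i) (measurableSet_ballEscape _ _)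
  have hvol : ∀ i, volume ((fun x => x - z i) ⁻¹' ballEscape (r i) w) =
      volume (ballEscape (r i) w) := fun i =>
    (measurePreserving_sub_right volume (z i)).measure_preimage
      (measurableSet_ballEscape _ _).nullMeasurableSet
  rw [translateEscape_iUnion_ball hz hr hw, measureReal_def, measure_iUnion
    (fun i j hij => (pairwise_disjoint_ball hz hr hij).mono (hsub i) (hsub j)) hmeas,
    ENNReal.tsum_toReal_eq fun i => measure_ne_top_of_subset (hsub i) measure_ball_lt_top.ne]
  simp only [hvol, measureReal_def]

end SeparatedBalls

theorem volume_iUnion_ball_ne_top {m : ℕ} [NeZero m] (z : ℕ → EuclideanSpace ℝ (Fin m))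
    {r : ℕ → ℝ} (hr : ∀ i, 0 ≤ r i) (hs : Summable fun i => r i ^ m) :
    volume (⋃ i, ball (z i) (r i)) ≠ ⊤ := by
  refine ne_top_of_le_ne_top ?_ (measure_iUnion_le _)
  simp only [Measure.addHaar_ball _ _ (hr _), finrank_euclideanSpace_fin]
  rw [ENNReal.tsum_mul_right]
  exact ENNReal.mul_ne_top hs.tsum_ofReal_ne_top measure_ball_lt_top.ne

/-- The volume that a translation by `w` moves out of the union of the balls is linear in `‖w‖`,
with quadratic error. -/
theorem exists_abs_volume_translateEscape_sub_le {n : ℕ} (hn : 2 ≤ n) {a α : ℝ} (ha : 0 < a)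
    (ha' : a ≤ 1 / 4) (hα : α = 1 / ((n : ℝ) - 1)) {z : ℕ → EuclideanSpace ℝ (Fin (n + 1))}
    (hz : ∀ i j, i ≠ j → 1 ≤ dist (z i) (z j)) {r : ℕ → ℝ}
    (hr : ∀ i : ℕ, r i = a * ((i : ℝ) + 1) ^ (-α)) :
    volume (⋃ i, ball (z i) (r i)) ≠ ⊤ ∧ ∃ C : ℝ, 0 ≤ C ∧ ∀ w,
      |volume.real (translateEscape (⋃ i, ball (z i) (r i)) w) -
          volume.real (ball (0 : EuclideanSpace ℝ (Fin n)) 1) * (∑' i, r i ^ n) * ‖w‖| ≤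
        C * ‖w‖ ^ 2 := by
  have : NeZero n := ⟨by lia⟩
  have hn' : (2 : ℝ) ≤ n := by exact_mod_cast hn
  have hα0 : 0 < α := by rw [hα]; exact one_div_pos.2 (by linarith)
  have hα1 : α ≤ 1 := by rw [hα, div_le_one (by linarith)]; linarith
  have hαn : α * n = 1 + α := by
    rw [hα]
    have : (n : ℝ) - 1 ≠ 0 := by linarith
    field_simp
    ring
  have hr0 : ∀ i, 0 < r i := fun i => by rw [hr]; positivity
  have hr4 : ∀ i, r i ≤ 1 / 4 := fun i => by
    have : ((i : ℝ) + 1) ^ (-α) ≤ 1 :=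
      Real.rpow_le_one_of_one_le_of_nonpos (by simp) (by linarith)
    rw [hr]
    nlinarith
  have hpow : ∀ i k : ℕ, r i ^ k ≤ ((i : ℝ) + 1) ^ (-α * k) := fun i k => by
    rw [hr, mul_pow, Real.rpow_mul_natCast (by positivity)]
    exact mul_le_of_le_one_left (by positivity) (pow_le_one₀ ha.le (by linarith))
  have hpow_n : ∀ i : ℕ, r i ^ n ≤ ((i : ℝ) + 1) ^ (-(1 + α)) := fun i => by
    have := hpow i n
    rwa [neg_mul, hαn] at this
  have hpow_n2 : ∀ i : ℕ, r i ^ (n - 2) ≤ ((i : ℝ) + 1) ^ (α - 1) := fun i => by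
    have := hpow i (n - 2)
    rwa [Nat.cast_sub hn, neg_mul, mul_sub, hαn, Nat.cast_ofNat,
      show -(1 + α - α * 2) = α - 1 by ring] at this
  have hsum : Summable fun i => r i ^ n :=
    (summable_add_one_rpow_neg hα0).of_nonneg_of_le (fun i => pow_nonneg (hr0 i).le _) hpow_n
  have hfin : volume (⋃ i, ball (z i) (r i)) ≠ ⊤ :=
    volume_iUnion_ball_ne_top z (fun i => (hr0 i).le) <|
      hsum.of_nonneg_of_le (fun i => pow_nonneg (hr0 i).le _) fun i =>
        pow_le_pow_of_le_one (hr0 i).le (by linarith [hr4 i]) n.le_succ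
  refine ⟨hfin, ?_⟩
  set Ω := ⋃ i, ball (z i) (r i) with hΩ
  set ω := volume.real (ball (0 : EuclideanSpace ℝ (Fin n)) 1) with hω
  set S := ∑' i, r i ^ n with hS
  have hω0 : 0 ≤ ω := measureReal_nonneg
  have hS0 : 0 ≤ S := tsum_nonneg fun i => pow_nonneg (hr0 i).le _
  have hV0 : 0 ≤ volume.real Ω := measureReal_nonneg
  refine ⟨3 * (ω * n) / α + (4 * volume.real Ω + 2 * (ω * S)), by positivity, fun w => ?_⟩
  rcases le_total ‖w‖ (1 / 2) with hw | hw
  · set e : ℕ → ℝ := fun i => ω * r i ^ n * ‖w‖ - volume.real (ballEscape (r i) w)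
    have hest := fun i => ballEscape_estimate (hr0 i) w
    have hs1 : Summable fun i => ω * r i ^ n * ‖w‖ := (hsum.mul_left ω).mul_right _
    have hs2 : Summable fun i => volume.real (ballEscape (r i) w) :=
      hs1.of_nonneg_of_le (fun i => measureReal_nonneg) fun i => by linarith [(hest i).1]
    have hdiff : ω * S * ‖w‖ - volume.real (translateEscape Ω w) = ∑' i, e i := by
      rw [hs1.tsum_sub hs2, tsum_mul_right, tsum_mul_left,
        volume_real_translateEscape_iUnion_ball hz hr4 hw]
    have hle : ∑' i, e i ≤ 3 * (ω * n) / α * ‖w‖ ^ 2 := by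
      refine tsum_le_of_le_rpow_of_le_rpow hα0 hα1 (by positivity) (norm_nonneg w)
        (by linarith) (fun i => (hest i).1) (fun i => ?_) (fun i => ?_)
      · calc e i ≤ ω * r i ^ n * ‖w‖ * (n * (‖w‖ ^ 2 / (4 * r i ^ 2))) := (hest i).2
          _ = ω * n * ‖w‖ ^ 3 * r i ^ (n - 2) / 4 := by
            rw [show r i ^ n = r i ^ (n - 2) * r i ^ 2 by rw [← pow_add, Nat.sub_add_cancel hn]]
            have := (hr0 i).ne'
            field_simp
          _ ≤ ω * n * ‖w‖ ^ 3 * r i ^ (n - 2) :=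
            div_le_self (mul_nonneg (by positivity) (pow_nonneg (hr0 i).le _)) (by norm_num)
          _ ≤ _ := mul_le_mul_of_nonneg_left (hpow_n2 i) (by positivity)
      · calc e i ≤ ω * r i ^ n * ‖w‖ := sub_le_self _ measureReal_nonneg
          _ = ω * 1 * ‖w‖ * r i ^ n := by ring
          _ ≤ ω * n * ‖w‖ * ((i : ℝ) + 1) ^ (-(1 + α)) := by
            have := hpow_n i
            have := (hr0 i).le
            gcongr
            linarith
    rw [abs_sub_comm, hdiff, abs_of_nonneg (tsum_nonneg fun i => (hest i).1), add_mul]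
    exact hle.trans (le_add_of_nonneg_right (by positivity))
  · have hD : volume.real (translateEscape Ω w) ≤ volume.real Ω :=
      measureReal_mono (fun x hx => hx.1) hfin
    have hD0 : 0 ≤ volume.real (translateEscape Ω w) := measureReal_nonneg
    have hw1 : 1 ≤ 4 * ‖w‖ ^ 2 := by nlinarith
    have hw2 : ‖w‖ ≤ 2 * ‖w‖ ^ 2 := by nlinarith
    have h1 := mul_le_mul_of_nonneg_left hw1 hV0
    have h2 := mul_le_mul_of_nonneg_left hw2 (mul_nonneg hω0 hS0)
    have h3 : 0 ≤ ω * S * ‖w‖ := by positivity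
    have h4 : 0 ≤ 3 * (ω * n) / α * ‖w‖ ^ 2 := by positivity
    rw [abs_le]
    constructor <;> nlinarith

/-- Theorem 4, borderline case `m > 2`, `α = 1/(m-2)`: for `Ω` the union of the balls
`B(z_i; a i^{-α})` centred at the points of `ℤᵐ`, the heat loss satisfies
`F_Ω(t) = π^{-1/2} Per(Ω) t^{1/2} + O(t log(1/t))` as `t ↓ 0`, where
`Per(Ω) = ∑_i m ω_m r_i^{m-1}`. -/
theorem heat_loss_asymptotics_borderline_case
    (m : ℕ) (hm : 2 < m) (a α : ℝ) (ha : 0 < a) (ha' : a ≤ 1 / 4)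
    (hα : α = 1 / ((m : ℝ) - 2))
    (z : ℕ → EuclideanSpace ℝ (Fin m)) (hz : IsLatticeEnum m z)
    (r : ℕ → ℝ) (hr : ∀ i : ℕ, r i = a * ((i : ℝ) + 1) ^ (-α))
    (Ω : Set (EuclideanSpace ℝ (Fin m))) (hΩ : Ω = ⋃ i : ℕ, ball (z i) (r i))
    (ω : ℝ) (hω : ω = (volume (ball (0 : EuclideanSpace ℝ (Fin m)) 1)).toReal)
    (P : ℝ) (hP : P = ∑' i : ℕ, (m : ℝ) * ω * r i ^ (m - 1)) :
    volume Ω ≠ ⊤ ∧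
    ∃ t₀ > (0 : ℝ), ∃ K > (0 : ℝ), ∀ t : ℝ, 0 < t → t < t₀ →
      heatContent Ω t ≠ ⊤ ∧
      |((volume Ω).toReal - (heatContent Ω t).toReal) -
          Real.pi ^ (-(1 : ℝ) / 2) * P * Real.sqrt t| ≤
        K * (t * Real.log (1 / t)) := by
  obtain ⟨n, rfl⟩ : ∃ n, m = n + 1 := ⟨m - 1, by lia⟩
  have hn : 2 ≤ n := by lia
  have : NeZero n := ⟨by lia⟩
  obtain ⟨hfin, C, hC0, hC⟩ := exists_abs_volume_translateEscape_sub_le hn ha ha'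
    (by rw [hα]; push_cast; ring) (fun i j => hz.one_le_dist) hr
  rw [← hΩ] at hfin hC
  have hmeas : MeasurableSet Ω := hΩ ▸ .iUnion fun i => measurableSet_ball
  set M := ((n + 1 : ℕ) : ℝ) * volume.real (ball (0 : EuclideanSpace ℝ (Fin (n + 1))) 1) *
    Real.pi ^ (-((n + 1 : ℕ) : ℝ) / 2) / 2 * Real.Gamma ((((n + 1 : ℕ) : ℝ) + (2 : ℕ)) / 2) with hM
  have hM0 : 0 ≤ M := by
    have := (Real.Gamma_pos_of_pos
      (show 0 < (((n + 1 : ℕ) : ℝ) + (2 : ℕ)) / 2 by positivity)).le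
    positivity
  refine ⟨hfin, Real.exp (-1), Real.exp_pos _, 4 * (C * M) + 1, by positivity, fun t ht ht' => ?_⟩
  refine ⟨(heatLoss_eq_integral (by lia) hmeas hfin ht).1, ?_⟩
  have hmain := abs_heatLoss_sub_le (by lia) hmeas hfin hC ht
  rw [integral_heatKernel_mul_norm_pow (by lia) ht 2, ← hM, Nat.cast_ofNat, div_self two_ne_zero,
    Real.rpow_one, mul_right_comm, integral_heatKernel_mul_norm ht] at hmain
  have hlog : 1 ≤ Real.log (1 / t) := by
    rw [one_div, Real.log_inv, le_neg, ← Real.log_exp (-1)]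
    exact Real.log_le_log ht ht'.le
  have hPt : Real.pi ^ (-(1 : ℝ) / 2) * P * √t = Real.pi ^ (-(1 : ℝ) / 2) *
      ((n + 1 : ℕ) * volume.real (ball (0 : EuclideanSpace ℝ (Fin (n + 1))) 1)) * √t *
        ∑' i, r i ^ n := by
    rw [hP, tsum_mul_left, hω, measureReal_def, Nat.add_sub_cancel]
    ring
  rw [hPt]
  calc _ ≤ C * (M * (4 * t)) := hmain
    _ ≤ (4 * (C * M) + 1) * (t * 1) := by linarith
    _ ≤ _ := by gcongr
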